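/- Let t ≥ 2 be an integer, let D be a finite simple Eulerian digraph, and let v_1, v_2, …, v_t be distinct vertices of D. Suppose that every edge-cut δ(X) of D that separates some pair of these vertices (i.e. with v_i ∈ X and v_j ∉ X for some i, j) has at least 2t(t-1) edges. Then D contains an immersion of the bidirected complete digraph K⃗_t. -/

import Mathlib

/-- `H` is immersed in `G` via the injective branch-vertex map `φ`:
for each edge `ab` of `H` there is a path in `G` from `φ a` to `φ b`,
and paths corresponding to distinct edges are pairwise edge-disjoint. -/
def SimpleGraph.ImmersionVia {W V : Type*} (H : SimpleGraph W) (G : SimpleGraph V)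
    (φ : W → V) : Prop :=
  Function.Injective φ ∧
  ∃ P : ∀ ⦃a b : W⦄, H.Adj a b → G.Walk (φ a) (φ b),
    (∀ ⦃a b⦄ (h : H.Adj a b), (P h).IsPath) ∧
    (∀ ⦃a b a' b'⦄ (h : H.Adj a b) (h' : H.Adj a' b'),
      s(a, b) ≠ s(a', b') → ∀ e ∈ (P h).edges, e ∉ (P h').edges)

/-- `H` is immersed in `G`. -/
def SimpleGraph.Immersion {W V : Type*} (H : SimpleGraph W) (G : SimpleGraph V) : Prop :=
  ∃ φ : W → V, H.ImmersionVia G φ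

/-- The edge-cut `δ(X)`: edges of `G` with exactly one endpoint in `X`. -/
def SimpleGraph.cutEdges {V : Type*} (G : SimpleGraph V) (X : Set V) : Set (Sym2 V) :=
  {e | e ∈ G.edgeSet ∧ ∃ a b, e = s(a, b) ∧ a ∈ X ∧ b ∉ X}

/-- A family of vertex sets is laminar (pairwise uncrossed). -/
def IsLaminar {V : Type*} (F : Set (Set V)) : Prop :=
  ∀ X ∈ F, ∀ Y ∈ F, X ⊆ Y ∨ X ⊆ Yᶜ ∨ Xᶜ ⊆ Y ∨ Xᶜ ⊆ Yᶜ

/-- The block containing `v` of the vertex partition induced by the family `F`. -/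
def laminarBlock {V : Type*} (F : Set (Set V)) (v : V) : Set V :=
  {u | ∀ X ∈ F, (u ∈ X ↔ v ∈ X)}

/-- A directed path from `x` to `y` in the digraph with adjacency relation `A`,
recorded as its (nonempty, duplicate-free) list of vertices. -/
def IsDiPath {V : Type*} (A : V → V → Prop) (x y : V) (l : List V) : Prop :=
  List.Chain' A l ∧ l.head? = some x ∧ l.getLast? = some y ∧ l.Nodup

/-- The directed edges traversed by a directed walk given by its vertex list. -/
def diWalkEdges {V : Type*} (l : List V) : List (V × V) := l.zip l.tail

/-- The digraph `F` is immersed in the digraph `A` via the injective map `φ`. -/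
def DiImmersionVia {W V : Type*} (F : W → W → Prop) (A : V → V → Prop) (φ : W → V) : Prop :=
  Function.Injective φ ∧
  ∃ P : ∀ ⦃a b : W⦄, F a b → List V,
    (∀ ⦃a b⦄ (h : F a b), IsDiPath A (φ a) (φ b) (P h)) ∧
    (∀ ⦃a b a' b'⦄ (h : F a b) (h' : F a' b'),
      (a, b) ≠ (a', b') → ∀ e ∈ diWalkEdges (P h), e ∉ diWalkEdges (P h'))

/-- The digraph `F` is immersed in the digraph `A`. -/
def DiImmersion {W V : Type*} (F : W → W → Prop) (A : V → V → Prop) : Prop :=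
  ∃ φ : W → V, DiImmersionVia F A φ

/-- The edge-cut `δ(X)` of a digraph: edges with exactly one endpoint in `X`
(in either direction). -/
def diCutEdges {V : Type*} (A : V → V → Prop) (X : Set V) : Set (V × V) :=
  {p | A p.1 p.2 ∧ ¬ (p.1 ∈ X ↔ p.2 ∈ X)}

/-- The outdegree of `v` in the digraph `A`. -/
noncomputable def diOutDeg {V : Type*} (A : V → V → Prop) (v : V) : ℕ := {u | A v u}.ncard

/-- The indegree of `v` in the digraph `A`. -/
noncomputable def diInDeg {V : Type*} (A : V → V → Prop) (v : V) : ℕ := {u | A u v}.ncard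

/-- An Eulerian digraph: loopless, and every vertex has indegree equal to outdegree. -/
def IsEulerianDigraph {V : Type*} (A : V → V → Prop) : Prop :=
  (∀ v, ¬ A v v) ∧ ∀ v : V, diInDeg A v = diOutDeg A v

/-- The bidirected complete digraph `K⃗ₜ` on `Fin t`. -/
def bidirComplete (t : ℕ) : Fin t → Fin t → Prop := fun a b => a ≠ b

/-- The net outflow of an edge set: at each vertex, its outdegree minus its indegree. -/
noncomputable def netOutflow {V : Type*} [DecidableEq V] (F : Finset (V × V)) : V → ℤ :=
  ∑ e ∈ F, (Pi.single e.1 1 - Pi.single e.2 1)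

/-- The arcs of the residual digraph of the edge set `F` inside `E`. -/
def ResidualArc {V : Type*} (E F : Finset (V × V)) (x y : V) : Prop :=
  ((x, y) ∈ E ∧ (x, y) ∉ F) ∨ (y, x) ∈ F

theorem exists_isDiPath_of_reflTransGen {V : Type*} {R : V → V → Prop} {x y : V}
    (h : Relation.ReflTransGen R x y) : ∃ l, IsDiPath R x y l := by
  classical
  induction h using Relation.ReflTransGen.head_induction_on with
  | refl => exact ⟨[y], List.isChain_singleton _, rfl, rfl, List.nodup_singleton _⟩
  | @head x z hxz _ ih =>
    obtain ⟨l, hc, hh, hl, hn⟩ := ih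
    by_cases hx : x ∈ l
    · obtain ⟨l₁, l₂, rfl⟩ := List.append_of_mem hx
      refine ⟨x :: l₂, (List.isChain_append.1 hc).2.1, rfl, ?_, (List.nodup_append.1 hn).2.1⟩
      simpa [List.getLast?_append] using hl
    · cases l with
      | nil => simp at hh
      | cons w l =>
        obtain rfl : w = z := by simpa using hh
        exact ⟨x :: w :: l, List.isChain_cons_cons.2 ⟨hxz, hc⟩, rfl,
          by simpa [List.getLast?_cons_cons] using hl, List.nodup_cons.2 ⟨hx, hn⟩⟩

theorem rel_of_mem_diWalkEdges {V : Type*} {R : V → V → Prop} {l : List V}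
    (hc : List.IsChain R l) {e : V × V} (he : e ∈ diWalkEdges l) : R e.1 e.2 := by
  induction l with
  | nil => simp [diWalkEdges] at he
  | cons x l ih =>
    cases l with
    | nil => simp [diWalkEdges] at he
    | cons y l =>
      rw [List.isChain_cons_cons] at hc
      rcases List.mem_cons.1 (show e ∈ (x, y) :: diWalkEdges (y :: l) from he) with rfl | he
      · exact hc.1
      · exact ih hc.2 he

section Flow

open Finset

variable {V : Type*} [DecidableEq V]

theorem sum_netOutflow (F : Finset (V × V)) (X : Finset V) :
    ∑ x ∈ X, netOutflow F x =
      (#{e ∈ F | e.1 ∈ X ∧ e.2 ∉ X} : ℤ) - #{e ∈ F | e.1 ∉ X ∧ e.2 ∈ X} := by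
  simp only [netOutflow, Finset.sum_apply, card_filter, Nat.cast_sum]
  rw [sum_comm, ← sum_sub_distrib]
  refine sum_congr rfl fun e _ => ?_
  simp only [Pi.sub_apply, sum_sub_distrib, Pi.single_apply, sum_ite_eq']
  by_cases h₁ : e.1 ∈ X <;> by_cases h₂ : e.2 ∈ X <;> simp [h₁, h₂]

theorem sum_univ_netOutflow [Fintype V] (F : Finset (V × V)) : ∑ x, netOutflow F x = 0 := by
  simp [sum_netOutflow]

theorem netOutflow_union {F G : Finset (V × V)} (h : Disjoint F G) :
    netOutflow (F ∪ G) = netOutflow F + netOutflow G :=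
  sum_union h

theorem netOutflow_sdiff {F G : Finset (V × V)} (h : G ⊆ F) :
    netOutflow (F \ G) = netOutflow F - netOutflow G :=
  eq_sub_of_add_eq (sum_sdiff h)

/-- Augmenting an edge set along a residual path. -/
theorem exists_netOutflow_of_residual_path {E : Finset (V × V)} {l : List V} :
    ∀ {F : Finset (V × V)} {x y : V}, F ⊆ E → IsDiPath (ResidualArc E F) x y l →
      ∃ F' ⊆ E, netOutflow F' = netOutflow F + Pi.single x 1 - Pi.single y 1 := by
  induction l with
  | nil => rintro F x y - ⟨-, hh, -⟩; simp at hh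
  | cons w l ih =>
    rintro F x y hF ⟨hc, hh, hl, hn⟩
    obtain rfl : w = x := by simpa using hh
    cases l with
    | nil =>
      obtain rfl : w = y := by simpa using hl
      exact ⟨F, hF, by simp⟩
    | cons z l =>
      obtain ⟨hwz, hc⟩ := List.isChain_cons_cons.1 hc
      obtain ⟨hw, hn⟩ := List.nodup_cons.1 hn
      obtain ⟨F₁, hF₁, hex, hsame⟩ : ∃ F₁ ⊆ E,
          netOutflow F₁ = netOutflow F + Pi.single w 1 - Pi.single z 1 ∧
          ∀ e : V × V, e.1 ≠ w → e.2 ≠ w → (e ∈ F₁ ↔ e ∈ F) := by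
        rcases hwz with ⟨hE, hwzF⟩ | hzw
        · refine ⟨insert (w, z) F, insert_subset hE hF, ?_, ?_⟩
          · rw [netOutflow, sum_insert hwzF, netOutflow]; abel
          · rintro ⟨a, b⟩ ha hb; simp_all
        · refine ⟨F.erase (z, w), (erase_subset _ _).trans hF, ?_, ?_⟩
          · rw [netOutflow, netOutflow, ← add_sum_erase F _ hzw]; abel
          · rintro ⟨a, b⟩ ha hb; simp_all
      have hc' : List.IsChain (ResidualArc E F₁) (z :: l) := by
        refine hc.imp_of_mem_imp fun a b ha hb hab => ?_
        have ha' : a ≠ w := fun h => hw (h ▸ ha)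
        have hb' : b ≠ w := fun h => hw (h ▸ hb)
        rwa [ResidualArc, hsame (a, b) ha' hb', hsame (b, a) hb' ha']
      obtain ⟨F', hF', h⟩ := ih (y := y) hF₁
        ⟨hc', rfl, by simpa [List.getLast?_cons_cons] using hl, hn⟩
      exact ⟨F', hF', by rw [h, hex]; abel⟩

/-- **Gale's feasibility theorem** with unit capacities. -/
theorem exists_subset_netOutflow_eq [Fintype V] (E : Finset (V × V)) (b : V → ℤ)
    (hb : ∑ x, b x = 0)
    (hcut : ∀ X : Finset V, ∑ x ∈ X, b x ≤ #{e ∈ E | e.1 ∈ X ∧ e.2 ∉ X}) :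
    ∃ F ⊆ E, netOutflow F = b := by
  classical
  obtain ⟨F, hF, hmin⟩ := exists_min_image E.powerset
    (fun F => ∑ x, |b x - netOutflow F x|) ⟨∅, empty_mem_powerset E⟩
  rw [mem_powerset] at hF
  refine ⟨F, hF, ?_⟩
  by_contra hne
  obtain ⟨x, hx⟩ : ∃ x, netOutflow F x < b x := by
    by_contra! hle
    refine hne (funext fun x => ?_)
    exact ((sum_eq_sum_iff_of_le fun i _ => hle i).1
      (hb.trans (sum_univ_netOutflow F).symm) x (mem_univ x)).symm
  set R : Finset V := {y | Relation.ReflTransGen (ResidualArc E F) x y} with hR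
  have hxR : x ∈ R := by simp [hR, Relation.ReflTransGen.refl]
  have hclosed : ∀ {a c}, a ∈ R → ResidualArc E F a c → c ∈ R := by
    simp only [hR, mem_filter, mem_univ, true_and]
    exact fun ha hac => ha.tail hac
  by_cases hy : ∃ y ∈ R, b y < netOutflow F y
  · obtain ⟨y, hyR, hy⟩ := hy
    obtain ⟨l, hl⟩ := exists_isDiPath_of_reflTransGen (mem_filter.1 hyR).2
    obtain ⟨F', hF', h⟩ := exists_netOutflow_of_residual_path hF hl
    refine (hmin F' (mem_powerset.2 hF')).not_gt (sum_lt_sum (fun z _ => ?_) ⟨x, mem_univ x, ?_⟩)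
    all_goals
      simp only [h, Pi.add_apply, Pi.sub_apply, Pi.single_apply]
      grind
  · push Not at hy
    have hlt : ∑ z ∈ R, netOutflow F z < ∑ z ∈ R, b z := sum_lt_sum hy ⟨x, hxR, hx⟩
    have hin : #{e ∈ F | e.1 ∉ R ∧ e.2 ∈ R} = 0 := by
      rw [card_eq_zero, filter_eq_empty_iff]
      exact fun e he ⟨h₁, h₂⟩ => h₁ (hclosed h₂ (Or.inr he))
    have hout : #{e ∈ E | e.1 ∈ R ∧ e.2 ∉ R} ≤ #{e ∈ F | e.1 ∈ R ∧ e.2 ∉ R} := by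
      refine card_le_card fun e he => ?_
      obtain ⟨heE, h₁, h₂⟩ := mem_filter.1 he
      exact mem_filter.2 ⟨by_contra fun h => h₂ (hclosed h₁ (Or.inl ⟨heE, h⟩)), h₁, h₂⟩
    rw [sum_netOutflow, hin] at hlt
    have := hcut R
    lia

theorem sum_single_sub_single (s d : V) (X : Finset V) :
    ∑ x ∈ X, (Pi.single s 1 - Pi.single d 1 : V → ℤ) x =
      (if s ∈ X then 1 else 0) - (if d ∈ X then 1 else 0) := by
  simp [sum_sub_distrib, Pi.single_apply]

theorem sum_netOutflow_le (F : Finset (V × V)) (X : Finset V) :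
    ∑ x ∈ X, netOutflow F x ≤ #{e ∈ F | e.1 ∈ X ∧ e.2 ∉ X} := by
  rw [sum_netOutflow]; lia

/-- A unit flow from `s` to `d` connects `s` to `d`. -/
theorem reflTransGen_of_netOutflow_eq [Fintype V] {F : Finset (V × V)} {s d : V}
    (h : netOutflow F = Pi.single s 1 - Pi.single d 1) :
    Relation.ReflTransGen (fun x y => (x, y) ∈ F) s d := by
  classical
  by_contra hd
  set R : Finset V := {y | Relation.ReflTransGen (fun x y => (x, y) ∈ F) s y} with hR
  have hsR : s ∈ R := by simp [hR, Relation.ReflTransGen.refl]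
  have hdR : d ∉ R := by simpa [hR] using hd
  have hle := sum_netOutflow_le F R
  have hout : #{e ∈ F | e.1 ∈ R ∧ e.2 ∉ R} = 0 := by
    rw [card_eq_zero, filter_eq_empty_iff]
    rintro ⟨a, c⟩ he ⟨h₁, h₂⟩
    simp only [hR, mem_filter, mem_univ, true_and] at h₁ h₂
    exact h₂ (h₁.tail he)
  rw [h, sum_single_sub_single, hout] at hle
  simp [hsR, hdR] at hle

/-- A flow with a common source or a common sink decomposes into unit flows. -/
theorem exists_unit_flow_decomposition [Fintype V] {ι : Type*} {s d : ι → V} {r : V}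
    (hr : (∀ k, s k = r) ∨ ∀ k, d k = r) (I : Finset ι) :
    ∀ F : Finset (V × V), netOutflow F = ∑ k ∈ I, (Pi.single (s k) 1 - Pi.single (d k) 1) →
      ∃ P : ι → Finset (V × V), (∀ k ∈ I, P k ⊆ F) ∧
        (∀ k ∈ I, netOutflow (P k) = Pi.single (s k) 1 - Pi.single (d k) 1) ∧
        ∀ k ∈ I, ∀ k' ∈ I, k ≠ k' → Disjoint (P k) (P k') := by
  classical
  induction I using Finset.induction_on with
  | empty => exact fun F _ => ⟨fun _ => ∅, by simp, by simp, by simp⟩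
  | insert i I hi ih =>
    intro F hF
    obtain ⟨Q, hQF, hQ⟩ := exists_subset_netOutflow_eq F
      (Pi.single (s i) 1 - Pi.single (d i) 1) (by rw [sum_single_sub_single]; simp) (by
        intro X
        have hle := sum_netOutflow_le F X
        rw [sum_single_sub_single]
        by_cases hX : s i ∈ X ∧ d i ∉ X
        · refine le_trans ?_ hle
          rw [hF, sum_insert hi]
          simp only [Pi.add_apply, sum_add_distrib, Finset.sum_apply]
          rw [sum_single_sub_single, sum_comm]
          refine le_add_of_nonneg_right (sum_nonneg fun k _ => ?_)
          rw [sum_single_sub_single]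
          rcases hr with hr | hr <;> rw [hr i] at hX <;> rw [hr k] <;> grind
        · grind)
    obtain ⟨P, hPF, hP, hdisj⟩ := ih (F \ Q) (by
      rw [netOutflow_sdiff hQF, hF, hQ, sum_insert hi, add_sub_cancel_left])
    have hPQ : ∀ k ∈ I, Disjoint (P k) Q := fun k hk =>
      (disjoint_sdiff_self_left).mono_left (hPF k hk)
    refine ⟨Function.update P i Q, ?_, ?_, ?_⟩
    · intro k hk
      rcases eq_or_ne k i with rfl | hki
      · simpa using hQF
      · simpa [hki] using (hPF k (mem_of_mem_insert_of_ne hk hki)).trans sdiff_subset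
    · intro k hk
      rcases eq_or_ne k i with rfl | hki
      · simpa using hQ
      · simpa [hki] using hP k (mem_of_mem_insert_of_ne hk hki)
    · intro k hk k' hk' hne
      rcases eq_or_ne k i with rfl | hki
      · simpa [hne.symm] using (hPQ k' (mem_of_mem_insert_of_ne hk' hne.symm)).symm
      · have hkI := mem_of_mem_insert_of_ne hk hki
        rcases eq_or_ne k' i with rfl | hki'
        · simpa [hki] using hPQ k hkI
        · simpa [hki, hki'] using hdisj k hkI k' (mem_of_mem_insert_of_ne hk' hki') hne

theorem netOutflow_apply (F : Finset (V × V)) (x : V) :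
    netOutflow F x = (#{e ∈ F | e.1 = x} : ℤ) - #{e ∈ F | e.2 = x} := by
  simp only [netOutflow, Finset.sum_apply, card_filter, Nat.cast_sum]
  rw [← sum_sub_distrib]
  refine sum_congr rfl fun e _ => ?_
  simp [Pi.single_apply, eq_comm]

theorem IsEulerianDigraph.netOutflow_eq_zero [Fintype V] {A : V → V → Prop}
    [DecidablePred fun e : V × V => A e.1 e.2] (h : IsEulerianDigraph A) :
    netOutflow {e : V × V | A e.1 e.2} = 0 := by
  classical
  funext x
  have hout : #{e : V × V | A e.1 e.2 ∧ e.1 = x} = diOutDeg A x := by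
    rw [diOutDeg, Set.ncard_eq_toFinset_card']
    refine card_bij' (fun e _ => e.2) (fun u _ => (x, u)) ?_ ?_ ?_ ?_ <;> aesop
  have hin : #{e : V × V | A e.1 e.2 ∧ e.2 = x} = diInDeg A x := by
    rw [diInDeg, Set.ncard_eq_toFinset_card']
    refine card_bij' (fun e _ => e.1) (fun u _ => (u, x)) ?_ ?_ ?_ ?_ <;> aesop
  rw [netOutflow_apply, filter_filter, filter_filter, hout, hin, h.2 x]
  simp

/-- In an Eulerian digraph exactly half of the edges of a cut leave the set. -/
theorem IsEulerianDigraph.ncard_diCutEdges [Fintype V] {A : V → V → Prop}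
    [DecidablePred fun e : V × V => A e.1 e.2] (h : IsEulerianDigraph A) (X : Finset V) :
    (diCutEdges A (X : Set V)).ncard =
      2 * #{e ∈ ({e | A e.1 e.2} : Finset (V × V)) | e.1 ∈ X ∧ e.2 ∉ X} := by
  have hbal := sum_netOutflow {e : V × V | A e.1 e.2} X
  rw [h.netOutflow_eq_zero] at hbal
  have hcut : diCutEdges A (X : Set V) =
      ↑({e ∈ ({e | A e.1 e.2} : Finset (V × V)) | e.1 ∈ X ∧ e.2 ∉ X} ∪
        {e ∈ ({e | A e.1 e.2} : Finset (V × V)) | e.1 ∉ X ∧ e.2 ∈ X}) := by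
    ext e
    simp only [diCutEdges, Set.mem_ofPred_eq, mem_coe, mem_union, mem_filter, mem_univ, true_and]
    tauto
  rw [hcut, Set.ncard_coe_finset, card_union_of_disjoint]
  · simp at hbal
    lia
  · refine disjoint_filter.2 ?_
    tauto

end Flow

/-- If `D` is a finite simple Eulerian digraph in which every edge-cut
separating a pair of the `t` distinct vertices `v 0, …, v (t-1)` has at least `2t(t-1)`
edges, then `D` immerses the bidirected complete digraph `K⃗_t`. -/
theorem stmt_5 {V : Type*} [Fintype V] (t : ℕ) (ht : 2 ≤ t) (A : V → V → Prop)
    (hEul : IsEulerianDigraph A)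
    (v : Fin t → V) (hv : Function.Injective v)
    (hcut : ∀ X : Set V, (∃ i j : Fin t, v i ∈ X ∧ v j ∉ X) →
      2 * t * (t - 1) ≤ (diCutEdges A X).ncard) :
    DiImmersion (bidirComplete t) A := by
  classical
  set E : Finset (V × V) := {e | A e.1 e.2} with hE
  have hE0 : netOutflow E = 0 := hEul.netOutflow_eq_zero
  let r : V := v ⟨0, by lia⟩
  let I : Finset (Fin t × Fin t) := Finset.univ.offDiag
  have hI : (I.card : ℤ) = t * (t - 1) := by
    simp only [I, Finset.offDiag_card, Finset.card_univ, Fintype.card_fin]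
    rw [Nat.cast_sub (Nat.le_mul_self t)]
    push_cast
    ring
  obtain ⟨F, hFE, hF⟩ := exists_subset_netOutflow_eq E
    (∑ k ∈ I, (Pi.single (v k.1) 1 - Pi.single r 1)) (by
      simp only [Finset.sum_apply]
      rw [Finset.sum_comm]
      exact Finset.sum_eq_zero fun k _ => by rw [sum_single_sub_single]; simp) (by
    intro X
    simp only [Finset.sum_apply]
    rw [Finset.sum_comm]
    simp only [sum_single_sub_single]
    by_cases hX : r ∉ X ∧ ∃ i, v i ∈ X
    · obtain ⟨hrX, i, hi⟩ := hX
      have hle := hcut X ⟨i, _, by simpa using hi, by simpa using hrX⟩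
      rw [hEul.ncard_diCutEdges X, mul_assoc] at hle
      have hle' : ((t * (t - 1) : ℕ) : ℤ) ≤
          ((E.filter fun e => e.1 ∈ X ∧ e.2 ∉ X).card : ℤ) := by
        exact_mod_cast Nat.le_of_mul_le_mul_left hle two_pos
      refine le_trans ?_ hle'
      rw [Nat.cast_mul, Nat.cast_sub (by lia), Nat.cast_one, ← hI, Finset.cast_card]
      exact Finset.sum_le_sum fun k _ => by split_ifs <;> simp
    · refine le_trans (Finset.sum_nonpos fun k _ => ?_) (Nat.cast_nonneg _)
      grind)
  obtain ⟨P, hPF, hP, hPdisj⟩ := exists_unit_flow_decomposition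
    (s := fun k : Fin t × Fin t => v k.1) (d := fun _ => r) (Or.inr fun _ => rfl) I F hF
  have hG : netOutflow (E \ F) = ∑ k ∈ I, (Pi.single r 1 - Pi.single (v k.2) 1) := by
    rw [netOutflow_sdiff hFE, hE0, hF, zero_sub, ← Finset.sum_neg_distrib]
    refine Finset.sum_bij' (fun k _ => k.swap) (fun k _ => k.swap) ?_ ?_ ?_ ?_ ?_ <;>
      simp [I, eq_comm]
  obtain ⟨Q, hQG, hQ, hQdisj⟩ := exists_unit_flow_decomposition
    (s := fun _ => r) (d := fun k : Fin t × Fin t => v k.2) (Or.inl fun _ => rfl) I (E \ F) hG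
  have hPQ : ∀ k ∈ I, ∀ k' ∈ I, Disjoint (P k) (Q k') := fun k hk k' hk' =>
    Finset.disjoint_sdiff.mono (hPF k hk) (hQG k' hk')
  have hmem : ∀ {a b : Fin t}, bidirComplete t a b → (a, b) ∈ I := fun {a b} h => by
    simpa [I] using (show a ≠ b from h)
  have hpath : ∀ a b : Fin t, bidirComplete t a b →
      ∃ l, IsDiPath (fun x y => (x, y) ∈ P (a, b) ∪ Q (a, b)) (v a) (v b) l := fun a b h =>
    exists_isDiPath_of_reflTransGen <| reflTransGen_of_netOutflow_eq <| by
      rw [netOutflow_union (hPQ _ (hmem h) _ (hmem h)), hP _ (hmem h), hQ _ (hmem h)]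
      simp
  choose L hL using hpath
  refine ⟨v, hv, fun a b h => L a b h, fun a b h => ⟨?_, (hL a b h).2⟩, ?_⟩
  · refine (hL a b h).1.imp fun x y hxy => ?_
    have hsub : P (a, b) ∪ Q (a, b) ⊆ E := Finset.union_subset
      ((hPF _ (hmem h)).trans hFE) ((hQG _ (hmem h)).trans Finset.sdiff_subset)
    simpa [hE] using hsub hxy
  · intro a b a' b' h h' hne e he he'
    have hdisj : Disjoint (P (a, b) ∪ Q (a, b)) (P (a', b') ∪ Q (a', b')) := by
      rw [Finset.disjoint_union_left, Finset.disjoint_union_right, Finset.disjoint_union_right]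
      exact ⟨⟨hPdisj _ (hmem h) _ (hmem h') hne, hPQ _ (hmem h) _ (hmem h')⟩,
        (hPQ _ (hmem h') _ (hmem h)).symm, hQdisj _ (hmem h) _ (hmem h') hne⟩
    exact Finset.disjoint_left.1 hdisj (rel_of_mem_diWalkEdges (hL a b h).1 he)
      (rel_of_mem_diWalkEdges (hL a' b' h').1 he')
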